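/- Let (L, η) be a localization on the category Ab of abelian groups, let R be a monoid object in Ab (i.e. an associative unital ring), and let (M, a) be a left R-module with action a : R ⊗ M ⟶ M. Then there exists a unique left R-module structure a' : R ⊗ LM ⟶ LM on LM such that η_M : M ⟶ LM is a morphism of left R-modules; moreover, equipping LR with the unique monoid structure for which η_R is a morphism of monoid objects, there exists a unique left LR-module structure a'' : LR ⊗ LM ⟶ LM on LM such that a'' ∘ (η_R ⊗ η_M) = η_M ∘ a. -/

import Mathlib

open CategoryTheory Category MonoidalCategory

/-- A monoid object structure on an object `A`: a multiplication `m` and unit `u`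
satisfying the unit and associativity axioms. -/
def MonoidAxioms {C : Type*} [Category C] [MonoidalCategory C]
    (A : C) (m : A ⊗ A ⟶ A) (u : 𝟙_ C ⟶ A) : Prop :=
  (u ▷ A) ≫ m = (λ_ A).hom ∧ (A ◁ u) ≫ m = (ρ_ A).hom ∧
    (m ▷ A) ≫ m = (α_ A A A).hom ≫ (A ◁ m) ≫ m

/-- A left module structure over a monoid object `(A, m, u)`. -/
def LeftModuleAxioms {C : Type*} [Category C] [MonoidalCategory C]
    {A : C} (m : A ⊗ A ⟶ A) (u : 𝟙_ C ⟶ A) (M : C) (a : A ⊗ M ⟶ M) : Prop :=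
  (u ▷ M) ≫ a = (λ_ M).hom ∧
    (m ▷ M) ≫ a = (α_ A A M).hom ≫ (A ◁ a) ≫ a

/-- `f` is orthogonal to all `L`-local objects. -/
def LOrth (L : ModuleCat.{0} ℤ ⥤ ModuleCat.{0} ℤ) {X Y : ModuleCat.{0} ℤ} (f : X ⟶ Y) : Prop :=
  ∀ W : ModuleCat.{0} ℤ, Function.Bijective (fun g : Y ⟶ L.obj W => f ≫ g)

theorem LOrth.comp {L : ModuleCat.{0} ℤ ⥤ ModuleCat.{0} ℤ} {X Y Z : ModuleCat.{0} ℤ}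
    {f : X ⟶ Y} {g : Y ⟶ Z} (hf : LOrth L f) (hg : LOrth L g) : LOrth L (f ≫ g) := by
  intro W
  have h := (hf W).comp (hg W)
  simpa [Function.comp_def] using h

theorem LOrth.cancel {L : ModuleCat.{0} ℤ ⥤ ModuleCat.{0} ℤ} {X Y W : ModuleCat.{0} ℤ}
    {f : X ⟶ Y} (hf : LOrth L f) {g h : Y ⟶ L.obj W} (H : f ≫ g = f ≫ h) : g = h :=
  (hf W).1 H

theorem LOrth.of_isIso {L : ModuleCat.{0} ℤ ⥤ ModuleCat.{0} ℤ} {X Y : ModuleCat.{0} ℤ}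
    (f : X ⟶ Y) [IsIso f] : LOrth L f := by
  intro W
  exact ⟨fun g h H => (cancel_epi f).1 H, fun g => ⟨inv f ≫ g, by simp⟩⟩

theorem whisker_bijective {S : Type} [CommRing S] (A X Y W : ModuleCat.{0} S) (f : X ⟶ Y)
    (hf : Function.Bijective (fun g : Y ⟶ W => f ≫ g)) :
    Function.Bijective (fun g : A ⊗ Y ⟶ W => A ◁ f ≫ g) := by
  have hb : Function.Bijective (LinearMap.lcomp S W f.hom) := by
    constructor
    · intro g h H
      have : ModuleCat.ofHom g = ModuleCat.ofHom h := hf.1 (by ext x; exact congr($H x))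
      exact congr(($this).hom)
    · intro g
      obtain ⟨k, hk⟩ := hf.2 (ModuleCat.ofHom g)
      exact ⟨k.hom, congr(($hk).hom)⟩
  let E := LinearEquiv.ofBijective _ hb
  constructor
  · intro g h H
    apply ModuleCat.hom_ext
    apply TensorProduct.ext
    ext1 x
    apply hb.1
    ext y
    have := congr(($H).hom (x ⊗ₜ[S] y))
    exact this
  · intro g
    refine ⟨ModuleCat.ofHom (TensorProduct.lift
      (E.symm.toLinearMap ∘ₗ TensorProduct.curry g.hom)), ?_⟩
    apply ModuleCat.hom_ext
    apply TensorProduct.ext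
    ext x y
    have := congr($(E.apply_symm_apply (TensorProduct.curry g.hom x)) y)
    exact this

theorem LOrth.whiskerLeft {L : ModuleCat.{0} ℤ ⥤ ModuleCat.{0} ℤ} {X Y : ModuleCat.{0} ℤ}
    {f : X ⟶ Y} (hf : LOrth L f) (A : ModuleCat.{0} ℤ) : LOrth L (A ◁ f) :=
  fun W => whisker_bijective A X Y (L.obj W) f (hf W)

theorem LOrth.whiskerRight {L : ModuleCat.{0} ℤ ⥤ ModuleCat.{0} ℤ} {X Y : ModuleCat.{0} ℤ}
    {f : X ⟶ Y} (hf : LOrth L f) (A : ModuleCat.{0} ℤ) : LOrth L (f ▷ A) := by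
  have : f ▷ A = (β_ X A).hom ≫ A ◁ f ≫ (β_ A Y).hom := by simp
  rw [this]
  exact (LOrth.of_isIso _).comp ((hf.whiskerLeft A).comp (LOrth.of_isIso _))

theorem LOrth.tensor {L : ModuleCat.{0} ℤ ⥤ ModuleCat.{0} ℤ} {X Y X' Y' : ModuleCat.{0} ℤ}
    {f : X ⟶ Y} {g : X' ⟶ Y'} (hf : LOrth L f) (hg : LOrth L g) : LOrth L (f ⊗ₘ g) := by
  rw [MonoidalCategory.tensorHom_def]
  exact (hf.whiskerRight _).comp (hg.whiskerLeft _)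

theorem LOrth.unit {L : ModuleCat.{0} ℤ ⥤ ModuleCat.{0} ℤ} (η : 𝟭 (ModuleCat ℤ) ⟶ L)
    (hη : ∀ X : ModuleCat ℤ, η.app (L.obj X) = L.map (η.app X))
    (hiso : ∀ X : ModuleCat ℤ, IsIso (L.map (η.app X))) (M : ModuleCat.{0} ℤ) :
    LOrth L (η.app M) := by
  intro W
  have hW : IsIso (η.app (L.obj W)) := by rw [hη]; exact hiso W
  have hM := hiso M
  constructor
  · intro g h H
    have H1 : L.map g = L.map h := by
      rw [← cancel_epi (L.map (η.app M)), ← L.map_comp, ← L.map_comp]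
      exact congrArg L.map H
    have h1 := η.naturality g
    have h2 := η.naturality h
    rw [H1, ← h2] at h1
    exact (cancel_mono (η.app (L.obj W))).1 h1
  · intro f
    refine ⟨L.map f ≫ inv (η.app (L.obj W)), ?_⟩
    have := η.naturality f
    replace this : f ≫ η.app (L.obj W) = η.app M ≫ L.map f := this
    change η.app M ≫ L.map f ≫ inv (η.app (L.obj W)) = f
    rw [← Category.assoc, ← this, Category.assoc, IsIso.hom_inv_id]
    exact Category.comp_id f

/-- For a localization `(L, η)` on the category `Ab` of abelian groups
(realized as `ModuleCat ℤ`), a monoid object `R` (i.e. a ring) and a left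
`R`-module `(M, a)`, there is a unique left `R`-module structure on `LM` making
`η_M` a module morphism; moreover, for the unique monoid structure on `LR` making
`η_R` a monoid morphism, there is a unique left `LR`-module structure `a''` on `LM`
with `a'' ∘ (η_R ⊗ η_M) = η_M ∘ a`. -/
theorem localization_on_ab_preserves_modules
    (L : ModuleCat ℤ ⥤ ModuleCat ℤ) (η : 𝟭 (ModuleCat ℤ) ⟶ L)
    (hη : ∀ X : ModuleCat ℤ, η.app (L.obj X) = L.map (η.app X))
    (hiso : ∀ X : ModuleCat ℤ, IsIso (L.map (η.app X)))
    (R : ModuleCat ℤ) (μ : R ⊗ R ⟶ R) (e : 𝟙_ (ModuleCat ℤ) ⟶ R)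
    (hR : MonoidAxioms R μ e)
    (M : ModuleCat ℤ) (a : R ⊗ M ⟶ M) (hM : LeftModuleAxioms μ e M a) :
    (∃! a' : R ⊗ L.obj M ⟶ L.obj M,
        LeftModuleAxioms μ e (L.obj M) a' ∧
        (R ◁ η.app M) ≫ a' = a ≫ η.app M) ∧
    (∀ (μ' : L.obj R ⊗ L.obj R ⟶ L.obj R) (e' : 𝟙_ (ModuleCat ℤ) ⟶ L.obj R),
        MonoidAxioms (L.obj R) μ' e' →
        (η.app R ⊗ₘ η.app R) ≫ μ' = μ ≫ η.app R →
        e' = e ≫ η.app R →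
        ∃! a'' : L.obj R ⊗ L.obj M ⟶ L.obj M,
          LeftModuleAxioms μ' e' (L.obj M) a'' ∧
          (η.app R ⊗ₘ η.app M) ≫ a'' = a ≫ η.app M) := by
  have key := LOrth.unit η hη hiso
  have hu := hM.1
  have ha := hM.2
  -- restate the unit maps with a transparent domain
  obtain ⟨ηR, hηR⟩ : ∃ f : R ⟶ L.obj R, f = η.app R := ⟨_, rfl⟩
  obtain ⟨ηM, hηM⟩ : ∃ f : M ⟶ L.obj M, f = η.app M := ⟨_, rfl⟩
  have kR : LOrth L ηR := hηR ▸ key R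
  have kM : LOrth L ηM := hηM ▸ key M
  change (∃! a' : R ⊗ L.obj M ⟶ L.obj M,
        LeftModuleAxioms μ e (L.obj M) a' ∧
        (R ◁ (show M ⟶ L.obj M from η.app M)) ≫ a' = a ≫ (show M ⟶ L.obj M from η.app M)) ∧
    (∀ (μ' : L.obj R ⊗ L.obj R ⟶ L.obj R) (e' : 𝟙_ (ModuleCat ℤ) ⟶ L.obj R),
        MonoidAxioms (L.obj R) μ' e' →
        ((show R ⟶ L.obj R from η.app R) ⊗ₘ (show R ⟶ L.obj R from η.app R)) ≫ μ'
          = μ ≫ (show R ⟶ L.obj R from η.app R) →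
        e' = e ≫ (show R ⟶ L.obj R from η.app R) →
        ∃! a'' : L.obj R ⊗ L.obj M ⟶ L.obj M,
          LeftModuleAxioms μ' e' (L.obj M) a'' ∧
          ((show R ⟶ L.obj R from η.app R) ⊗ₘ (show M ⟶ L.obj M from η.app M)) ≫ a''
            = a ≫ (show M ⟶ L.obj M from η.app M))
  rw [← hηR, ← hηM]
  clear hηR hηM
  constructor
  · obtain ⟨a', h⟩ := (kM.whiskerLeft R M).2 (a ≫ ηM)
    replace h : R ◁ ηM ≫ a' = a ≫ ηM := h
    refine ⟨a', ⟨⟨?_, ?_⟩, h⟩, ?_⟩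
    · apply (kM.whiskerLeft _).cancel
      rw [whisker_exchange_assoc, h, reassoc_of% hu, leftUnitor_naturality]
    · apply (kM.whiskerLeft _).cancel
      rw [whisker_exchange_assoc, h, reassoc_of% ha, tensor_whiskerLeft]
      simp only [Category.assoc, Iso.inv_hom_id_assoc]
      rw [← whiskerLeft_comp_assoc, h, whiskerLeft_comp_assoc, h]
    · rintro b ⟨-, hb⟩
      exact (kM.whiskerLeft R).cancel (hb.trans h.symm)
  · intro μ' e' _ hμ he
    obtain ⟨b, h⟩ := (kR.tensor kM M).2 (a ≫ ηM)
    replace h : (ηR ⊗ₘ ηM) ≫ b = a ≫ ηM := h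
    refine ⟨b, ⟨⟨?_, ?_⟩, h⟩, ?_⟩
    · apply (kM.whiskerLeft _).cancel
      rw [whisker_exchange_assoc, he, comp_whiskerRight, Category.assoc, ← tensorHom_def_assoc, h,
        reassoc_of% hu, leftUnitor_naturality]
    · apply ((kR.tensor kR).tensor kM).cancel
      have h1 : ((ηR ⊗ₘ ηR) ⊗ₘ ηM) ≫ μ' ▷ L.obj M = μ ▷ M ≫ (ηR ⊗ₘ ηM) := by
        rw [← tensorHom_id, tensorHom_comp_tensorHom, hμ, ← tensorHom_id,
          tensorHom_comp_tensorHom]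
        simp
      have h2 : (ηR ⊗ₘ (ηR ⊗ₘ ηM)) ≫ L.obj R ◁ b = R ◁ a ≫ (ηR ⊗ₘ ηM) := by
        rw [← id_tensorHom, tensorHom_comp_tensorHom, h, ← id_tensorHom,
          tensorHom_comp_tensorHom]
        simp
      rw [reassoc_of% h1, h, reassoc_of% ha, associator_naturality_assoc, reassoc_of% h2, h]
    · rintro c ⟨-, hc⟩
      exact (kR.tensor kM).cancel (hc.trans h.symm)
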